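/- Let A be a regular Hopf coquasigroup over a field k with a faithful left integral φ. Suppose δ ∈ A is invertible with φ(a₍₁₎)a₍₂₎ = φ(a)δ and φ(S(a)) = φ(aδ) for all a ∈ A, and τ ∈ k satisfies φ(S²(a)) = τ·φ(a) for all a ∈ A. Then φ(δ⁻¹ a δ) = τ·φ(a) for all a ∈ A. -/

import Mathlib

open TensorProduct

/-- A regular Hopf coquasigroup over a field `k`: a unital associative `k`-algebra `A`
with a (not necessarily coassociative) coproduct `comul : A →ₐ[k] A ⊗[k] A`, a counit
`counit : A →ₐ[k] k`, and a bijective antipode `antipode : A ≃ₗ[k] A` which is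
antimultiplicative, anticomultiplicative, and satisfies the quasigroup antipode
identities. -/
structure RegularHopfCoquasigroup (k A : Type*) [Field k] [Ring A] [Algebra k A] where
  comul : A →ₐ[k] A ⊗[k] A
  counit : A →ₐ[k] k
  antipode : A ≃ₗ[k] A
  /-- `(ε ⊗ id) ∘ Δ = id` -/
  counit_comul_left : ∀ a : A,
    (TensorProduct.lid k A) ((LinearMap.rTensor A counit.toLinearMap) (comul a)) = a
  /-- `(id ⊗ ε) ∘ Δ = id` -/
  counit_comul_right : ∀ a : A,
    (TensorProduct.rid k A) ((LinearMap.lTensor A counit.toLinearMap) (comul a)) = a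
  /-- `S(ab) = S(b)S(a)` -/
  antipode_mul : ∀ a b : A, antipode (a * b) = antipode b * antipode a
  /-- `S(1) = 1` -/
  antipode_one : antipode (1 : A) = 1
  /-- `Δ ∘ S = (S ⊗ S) ∘ flip ∘ Δ` -/
  antipode_comul : ∀ a : A,
    comul (antipode a) =
      (TensorProduct.map antipode.toLinearMap antipode.toLinearMap)
        ((TensorProduct.comm k A A) (comul a))
  /-- `S(a₍₁₎)a₍₂₎₍₁₎ ⊗ a₍₂₎₍₂₎ = 1 ⊗ a` -/
  quasi₁ : ∀ a : A,
    (LinearMap.rTensor A (LinearMap.mul' k A))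
      ((TensorProduct.assoc k A A A).symm
        ((LinearMap.rTensor (A ⊗[k] A) antipode.toLinearMap)
          ((LinearMap.lTensor A comul.toLinearMap) (comul a)))) = (1 : A) ⊗ₜ[k] a
  /-- `a₍₁₎S(a₍₂₎₍₁₎) ⊗ a₍₂₎₍₂₎ = 1 ⊗ a` -/
  quasi₂ : ∀ a : A,
    (LinearMap.rTensor A (LinearMap.mul' k A))
      ((TensorProduct.assoc k A A A).symm
        ((LinearMap.lTensor A (LinearMap.rTensor A antipode.toLinearMap))
          ((LinearMap.lTensor A comul.toLinearMap) (comul a)))) = (1 : A) ⊗ₜ[k] a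
  /-- `a₍₁₎₍₁₎ ⊗ S(a₍₁₎₍₂₎)a₍₂₎ = a ⊗ 1` -/
  quasi₃ : ∀ a : A,
    (LinearMap.lTensor A (LinearMap.mul' k A))
      ((TensorProduct.assoc k A A A)
        ((LinearMap.rTensor A (LinearMap.lTensor A antipode.toLinearMap))
          ((LinearMap.rTensor A comul.toLinearMap) (comul a)))) = a ⊗ₜ[k] (1 : A)
  /-- `a₍₁₎₍₁₎ ⊗ a₍₁₎₍₂₎S(a₍₂₎) = a ⊗ 1` -/
  quasi₄ : ∀ a : A,
    (LinearMap.lTensor A (LinearMap.mul' k A))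
      ((TensorProduct.assoc k A A A)
        ((LinearMap.lTensor (A ⊗[k] A) antipode.toLinearMap)
          ((LinearMap.rTensor A comul.toLinearMap) (comul a)))) = a ⊗ₜ[k] (1 : A)

variable {k A : Type*} [Field k] [Ring A] [Algebra k A]

/-- `(id ⊗ f)` on `A ⊗[k] A`, composed with `A ⊗ k ≅ A`; so `idT f (a ⊗ b) = f b • a`,
i.e. in Sweedler notation `idT f (Δ a) = a₍₁₎ f(a₍₂₎)`. -/
noncomputable def idT (f : A →ₗ[k] k) : A ⊗[k] A →ₗ[k] A :=
  (TensorProduct.rid k A).toLinearMap ∘ₗ LinearMap.lTensor A f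

/-- `(f ⊗ id)` on `A ⊗[k] A`, composed with `k ⊗ A ≅ A`; so `Tid f (a ⊗ b) = f a • b`,
i.e. in Sweedler notation `Tid f (Δ a) = f(a₍₁₎) a₍₂₎`. -/
noncomputable def Tid (f : A →ₗ[k] k) : A ⊗[k] A →ₗ[k] A :=
  (TensorProduct.lid k A).toLinearMap ∘ₗ LinearMap.rTensor A f

/-- A linear functional `f` on `A` is faithful if `f(a·) = 0` implies `a = 0` and
`f(·a) = 0` implies `a = 0`. -/
def Faithful (f : A →ₗ[k] k) : Prop :=
  (∀ a : A, (∀ b : A, f (a * b) = 0) → a = 0) ∧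
  (∀ a : A, (∀ b : A, f (b * a) = 0) → a = 0)

/-- A left integral: a nonzero functional `φ` with `a₍₁₎ φ(a₍₂₎) = φ(a)·1`. -/
def IsLeftIntegral (H : RegularHopfCoquasigroup k A) (φ : A →ₗ[k] k) : Prop :=
  φ ≠ 0 ∧ ∀ a : A, idT φ (H.comul a) = φ a • (1 : A)

/-- A right integral: a nonzero functional `ψ` with `ψ(a₍₁₎) a₍₂₎ = ψ(a)·1`. -/
def IsRightIntegral (H : RegularHopfCoquasigroup k A) (ψ : A →ₗ[k] k) : Prop :=
  ψ ≠ 0 ∧ ∀ a : A, Tid ψ (H.comul a) = ψ a • (1 : A)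


@[simp]
theorem idT_tmul (f : A →ₗ[k] k) (x y : A) : idT f (x ⊗ₜ[k] y) = f y • x := by
  simp [idT]

@[simp]
theorem Tid_tmul (f : A →ₗ[k] k) (x y : A) : Tid f (x ⊗ₜ[k] y) = f x • y := by
  simp [Tid]

theorem Tid_mul_one_tmul (f : A →ₗ[k] k) (t : A ⊗[k] A) (z : A) :
    Tid f (t * (1 ⊗ₜ[k] z)) = Tid f t * z := by
  induction t with
  | zero => simp
  | tmul x y => simp
  | add u v hu hv => rw [add_mul, map_add, map_add, hu, hv, add_mul]

theorem lTensor_mul'_assoc_tmul (u : A ⊗[k] A) (z : A) :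
    LinearMap.lTensor A (LinearMap.mul' k A) (TensorProduct.assoc k A A A (u ⊗ₜ[k] z)) =
      u * (1 ⊗ₜ[k] z) := by
  induction u with
  | zero => simp
  | tmul x y => simp
  | add u v hu hv => rw [TensorProduct.add_tmul, map_add, map_add, hu, hv, add_mul]

/-- Slicing `t` in the second leg by an arbitrary functional commutes with slicing it
in the first leg. -/
theorem apply_idT_eq_apply_Tid (f g : A →ₗ[k] k) (t : A ⊗[k] A) :
    f (idT g t) = g (Tid f t) := by
  induction t with
  | zero => simp
  | tmul x y => simp [mul_comm]
  | add u v hu hv => simp only [map_add, hu, hv]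

/-- A faithful functional separates the first leg of `A ⊗ A`. -/
theorem Faithful.Tid_eq_zero {φ : A →ₗ[k] k} (hf : Faithful φ) {t : A ⊗[k] A}
    (h : ∀ a : A, Tid (φ ∘ₗ LinearMap.mulLeft k a) t = 0) (e : A →ₗ[k] k) :
    Tid e t = 0 := by
  rw [← Module.forall_dual_apply_eq_zero_iff k]
  intro g
  rw [← apply_idT_eq_apply_Tid, hf.2 (idT g t), map_zero]
  intro a
  have := apply_idT_eq_apply_Tid (φ ∘ₗ LinearMap.mulLeft k a) g t
  rwa [h, map_zero] at this

namespace RegularHopfCoquasigroup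

variable (H : RegularHopfCoquasigroup k A) {φ : A →ₗ[k] k} {δ : A}

/-- If `φ` is left invariant and `φ ∘ S = φ(· δ)`, then `φ(· δ)` is right invariant. -/
theorem Tid_comul_mul_tmul_one (hφ : ∀ a : A, idT φ (H.comul a) = φ a • (1 : A))
    (hSδ : ∀ a : A, φ (H.antipode a) = φ (a * δ)) (a : A) :
    Tid φ (H.comul a * (δ ⊗ₜ[k] 1)) = φ (a * δ) • (1 : A) := by
  have key (t : A ⊗[k] A) :
      idT φ (TensorProduct.map H.antipode.toLinearMap H.antipode.toLinearMap
        (TensorProduct.comm k A A t)) = H.antipode (Tid φ (t * (δ ⊗ₜ[k] 1))) := by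
    induction t with
    | zero => simp
    | tmul x y => simp [hSδ]
    | add u v hu hv => simp only [map_add, hu, hv, add_mul]
  apply H.antipode.injective
  rw [← key, ← H.antipode_comul, hφ, hSδ, map_smul, H.antipode_one]

/-- `φ(a₍₁₎ b) a₍₂₎ = φ(a b₍₁₎) δ S(b₍₂₎)`. -/
theorem Tid_comul_mul_tmul_one_eq (hmod : ∀ a : A, Tid φ (H.comul a) = φ a • δ) (a b : A) :
    Tid φ (H.comul a * (b ⊗ₜ[k] 1)) = Tid (φ ∘ₗ LinearMap.mulLeft k a)
      (LinearMap.lTensor A (LinearMap.mulLeft k δ ∘ₗ H.antipode.toLinearMap) (H.comul b)) := by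
  have key (t : A ⊗[k] A) :
      Tid φ (H.comul a * LinearMap.lTensor A (LinearMap.mul' k A)
        (TensorProduct.assoc k A A A
          (LinearMap.lTensor (A ⊗[k] A) H.antipode.toLinearMap
            (LinearMap.rTensor A H.comul.toLinearMap t)))) =
      Tid (φ ∘ₗ LinearMap.mulLeft k a)
        (LinearMap.lTensor A (LinearMap.mulLeft k δ ∘ₗ H.antipode.toLinearMap) t) := by
    induction t with
    | zero => simp
    | tmul x y =>
      rw [LinearMap.rTensor_tmul, LinearMap.lTensor_tmul, lTensor_mul'_assoc_tmul, ← mul_assoc,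
        Tid_mul_one_tmul, AlgHom.toLinearMap_apply, ← map_mul, hmod]
      simp
    | add u v hu hv => simp only [map_add, mul_add, hu, hv]
  rw [← H.quasi₄ b, key]

theorem mul_antipode_modular (hφ : IsLeftIntegral H φ) (hf : Faithful φ)
    (hmod : ∀ a : A, Tid φ (H.comul a) = φ a • δ)
    (hSδ : ∀ a : A, φ (H.antipode a) = φ (a * δ)) : δ * H.antipode δ = 1 := by
  have counit_Tid (L : A →ₗ[k] A) (t : A ⊗[k] A) :
      Tid H.counit.toLinearMap (LinearMap.lTensor A L t) = L (Tid H.counit.toLinearMap t) := by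
    induction t with
    | zero => simp
    | tmul x y => simp
    | add u v hu hv => simp only [map_add, hu, hv]
  have counit_modular : H.counit δ = 1 := by
    obtain ⟨a, ha⟩ : ∃ a, φ a ≠ 0 := by
      by_contra! h
      exact hφ.1 (LinearMap.ext h)
    have h := apply_idT_eq_apply_Tid φ H.counit.toLinearMap (H.comul a)
    have hr : idT H.counit.toLinearMap (H.comul a) = a := H.counit_comul_right a
    rw [hmod, hr] at h
    simp only [map_smul, AlgHom.toLinearMap_apply, smul_eq_mul] at h
    exact mul_left_cancel₀ ha (by rw [← h, mul_one])
  have h := hf.Tid_eq_zero (t := LinearMap.lTensor A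
    (LinearMap.mulLeft k δ ∘ₗ H.antipode.toLinearMap) (H.comul δ) - δ ⊗ₜ[k] 1)
    (fun a => by
      rw [map_sub, ← H.Tid_comul_mul_tmul_one_eq hmod, H.Tid_comul_mul_tmul_one hφ.2 hSδ]
      simp) H.counit.toLinearMap
  have hl : Tid H.counit.toLinearMap (H.comul δ) = δ := H.counit_comul_left δ
  rw [map_sub, counit_Tid, hl] at h
  simpa [counit_modular, sub_eq_zero] using h

end RegularHopfCoquasigroup

/-- with the modular element `δ` and `φ∘S² = τφ`, one has
`φ(δ⁻¹ a δ) = τ·φ(a)`. -/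
theorem stmt_11 (k A : Type*) [Field k] [Ring A] [Algebra k A]
    (H : RegularHopfCoquasigroup k A) (φ : A →ₗ[k] k)
    (hφ : IsLeftIntegral H φ) (hf : Faithful φ)
    (δ δi : A) (hδ1 : δ * δi = 1) (hδ2 : δi * δ = 1)
    (hmod : ∀ a : A, Tid φ (H.comul a) = φ a • δ)
    (hSδ : ∀ a : A, φ (H.antipode a) = φ (a * δ))
    (τ : k) (hτ : ∀ a : A, φ (H.antipode (H.antipode a)) = τ * φ a) :
    ∀ a : A, φ (δi * a * δ) = τ * φ a := by
  intro a
  have hS : H.antipode δ = δi := by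
    rw [← one_mul (H.antipode δ), ← hδ2, mul_assoc, H.mul_antipode_modular hφ hf hmod hSδ, mul_one]
  have hSi : H.antipode δi = δ := by
    rw [← mul_one (H.antipode δi), ← hδ2, ← mul_assoc, ← hS, ← H.antipode_mul, hS, hδ1,
      H.antipode_one, one_mul]
  rw [← hSδ, H.antipode_mul, hSi, ← hSδ, hτ]
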